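/- Let R be an algebraic curvature tensor on ℝⁿ, let 1 ≤ p ≤ n−1, and let (u¹,…,uⁿ) be an orthonormal basis of ℝⁿ. Then ⟨R^p(u¹ ∧ … ∧ u^p), u¹ ∧ … ∧ u^p⟩ = Σ_{i=1}^p Σ_{j=p+1}^n K(uⁱ,uʲ). -/

import Mathlib

open scoped BigOperators RealInnerProductSpace

noncomputable section

/-- An algebraic curvature tensor on a real module: a quadrilinear form with the
symmetries of the Riemann curvature tensor. -/
structure AlgCurv (V : Type*) [AddCommGroup V] [Module ℝ V] where
  T : V →ₗ[ℝ] V →ₗ[ℝ] V →ₗ[ℝ] V →ₗ[ℝ] ℝ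
  antisym₁ : ∀ x y z w, T x y z w = - T y x z w
  antisym₂ : ∀ x y z w, T x y z w = - T x y w z
  pairsym : ∀ x y z w, T x y z w = T z w x y
  bianchi : ∀ x y z w, T x y z w + T y z x w + T z x y w = 0

/-- Coordinates of the exterior algebra of ℝⁿ in the orthonormal basis `e^S`,
`S` ranging over subsets of `{1,…,n}`. -/
abbrev ExtCoord (n : ℕ) := Finset (Fin n) → ℝ

/-- The sign `(-1)^{#{m ∈ S : m < i}}`. -/
def sgn {n : ℕ} (i : Fin n) (S : Finset (Fin n)) : ℝ :=
  (-1 : ℝ) ^ (S.filter fun m => m < i).card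

/-- Exterior multiplication `(aⁱ)*` by `e_i`, in coordinates. -/
def wedgeE {n : ℕ} (i : Fin n) (f : ExtCoord n) : ExtCoord n :=
  fun S => if i ∈ S then sgn i S * f (S.erase i) else 0

/-- Interior multiplication `aⁱ` by `e_i`, in coordinates. -/
def contrE {n : ℕ} (i : Fin n) (f : ExtCoord n) : ExtCoord n :=
  fun S => if i ∈ S then 0 else sgn i S * f (insert i S)

/-- Weitzenböck operator built from curvature components via Witten's formula
`R^p = Σ_{i,j,k,l} R_{ijkl} (aⁱ)* aʲ (aᵏ)* aˡ`. -/
def weitzOp {n : ℕ} (c : Fin n → Fin n → Fin n → Fin n → ℝ) (f : ExtCoord n) : ExtCoord n :=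
  ∑ i, ∑ j, ∑ k, ∑ l, c i j k l • wedgeE i (contrE j (wedgeE k (contrE l f)))

/-- The standard orthonormal basis vector `e_i` of ℝⁿ. -/
def estd {n : ℕ} (i : Fin n) : EuclideanSpace ℝ (Fin n) := EuclideanSpace.single i 1

/-- The Weitzenböck curvature operator of an algebraic curvature tensor on ℝⁿ. -/
def weitz {n : ℕ} (R : AlgCurv (EuclideanSpace ℝ (Fin n))) (f : ExtCoord n) : ExtCoord n :=
  weitzOp (fun i j k l => R.T (estd i) (estd j) (estd k) (estd l)) f

/-- The inner product on the exterior algebra making the `e^S` orthonormal. -/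
def extInner {n : ℕ} (f g : ExtCoord n) : ℝ := ∑ S : Finset (Fin n), f S * g S

/-- The basis element `e^S` of the exterior algebra. -/
def eB {n : ℕ} (S : Finset (Fin n)) : ExtCoord n := fun T => if T = S then 1 else 0

/-- Sectional curvature `K(u,v) = -R(u,v,u,v)` (paper's sign convention). -/
def sectK {V : Type*} [AddCommGroup V] [Module ℝ V] (R : AlgCurv V) (u v : V) : ℝ :=
  - R.T u v u v

/-- Wedging with a vector `x ∈ ℝⁿ`, in coordinates. -/
def wedgeV {n : ℕ} (x : EuclideanSpace ℝ (Fin n)) (f : ExtCoord n) : ExtCoord n :=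
  ∑ i, x i • wedgeE i f

/-- The wedge product `u¹ ∧ … ∧ u^p` of a family of vectors. -/
def wedgeFam {n p : ℕ} (u : Fin p → EuclideanSpace ℝ (Fin n)) : ExtCoord n :=
  (List.ofFn u).foldr wedgeV (eB ∅)

/-- The sum of sectional curvatures `Σ_{i=1}^p Σ_{j=p+1}^n K(vⁱ,vʲ)`. -/
def sumK {n : ℕ} (R : AlgCurv (EuclideanSpace ℝ (Fin n))) (p : ℕ)
    (v : Fin n → EuclideanSpace ℝ (Fin n)) : ℝ :=
  ∑ i ∈ Finset.univ.filter (fun i : Fin n => (i : ℕ) < p),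
    ∑ j ∈ Finset.univ.filter (fun j : Fin n => p ≤ (j : ℕ)), sectK R (v i) (v j)

/-- The constant `D = (1/2)p(n−p) + (4/3)·binom(p,2)·binom(n−p,2)`. -/
def Dconst (n p : ℕ) : ℝ :=
  (1 : ℝ) / 2 * ((p * (n - p) : ℕ) : ℝ)
    + (4 : ℝ) / 3 * ((p.choose 2 * ((n - p).choose 2) : ℕ) : ℝ)

/-- The pinching constant `C(n,p) = D/(1+D)`. -/
def Cnp (n p : ℕ) : ℝ := Dconst n p / (1 + Dconst n p)


lemma sgn_mul_self {n : ℕ} (i : Fin n) (S : Finset (Fin n)) : sgn i S * sgn i S = 1 := by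
  unfold sgn
  rw [← mul_pow]
  simp

lemma sgn_insert {n : ℕ} (i j : Fin n) {S : Finset (Fin n)} (hj : j ∉ S) :
    sgn i (insert j S) = if j < i then - sgn i S else sgn i S := by
  unfold sgn
  rw [Finset.filter_insert]
  split_ifs
  · rw [Finset.card_insert_of_notMem (by simp [hj]), pow_succ]
    ring
  · rfl

lemma sgn_erase {n : ℕ} (i j : Fin n) {S : Finset (Fin n)} (hj : j ∈ S) :
    sgn i (S.erase j) = if j < i then - sgn i S else sgn i S := by
  have h := sgn_insert i j (Finset.notMem_erase j S)
  rw [Finset.insert_erase hj] at h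
  rw [h]
  split_ifs <;> simp

lemma wedgeE_wedgeE {n : ℕ} (i j : Fin n) (f : ExtCoord n) :
    wedgeE i (wedgeE j f) = - wedgeE j (wedgeE i f) := by
  ext S
  simp only [wedgeE, Pi.neg_apply, Finset.mem_erase]
  by_cases hi : i ∈ S <;> by_cases hj : j ∈ S <;> simp only [hi, hj] <;> try simp
  rcases lt_trichotomy i j with h | rfl | h
  · simp [h.ne, h.ne', sgn_erase _ _ hi, sgn_erase _ _ hj, h, h.not_gt,
      Finset.erase_right_comm (a := i)]
    ring
  · simp
  · simp [h.ne, h.ne', sgn_erase _ _ hi, sgn_erase _ _ hj, h, h.not_gt,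
      Finset.erase_right_comm (a := i)]
    ring

lemma contrE_wedgeE {n : ℕ} (i j : Fin n) (f : ExtCoord n) :
    contrE i (wedgeE j f) = (if i = j then f else 0) - wedgeE j (contrE i f) := by
  ext S
  by_cases hij : i = j
  · subst hij
    by_cases hi : i ∈ S
    · simp [contrE, wedgeE, hi, sgn_erase, ← mul_assoc, sgn_mul_self]
    · simp [contrE, wedgeE, hi, sgn_insert, ← mul_assoc, sgn_mul_self]
  · have hji : j ≠ i := Ne.symm hij
    by_cases hi : i ∈ S <;> by_cases hj : j ∈ S <;>
      simp [contrE, wedgeE, hi, hj, hij, hji]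
    rw [sgn_insert _ _ hi, sgn_erase _ _ hj, Finset.erase_insert_of_ne hij]
    rcases lt_or_gt_of_ne hij with h | h <;> simp [h, h.not_gt] <;> ring

lemma extInner_wedgeE {n : ℕ} (i : Fin n) (f g : ExtCoord n) :
    extInner (wedgeE i f) g = extInner f (contrE i g) := by
  simp only [extInner, wedgeE, contrE, ite_mul, zero_mul, mul_ite, mul_zero]
  have h : ∀ S : Finset (Fin n), (if i ∈ S then 0 else f S * (sgn i S * g (insert i S))) =
      if i ∉ S then f S * (sgn i S * g (insert i S)) else 0 := fun S => by split_ifs <;> rfl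
  simp only [h]
  rw [← Finset.sum_filter, ← Finset.sum_filter]
  refine Finset.sum_bij' (fun S _ => S.erase i) (fun S _ => insert i S) ?_ ?_ ?_ ?_ ?_
  · simp
  · simp
  · intro S hS
    exact Finset.insert_erase (by simpa using hS)
  · intro S hS
    exact Finset.erase_insert (by simpa using hS)
  · intro S hS
    have hS : i ∈ S := by simpa using hS
    simp only [Finset.insert_erase hS, sgn_erase i i hS, lt_irrefl, if_false]
    ring

/-- Exterior multiplication as a bilinear map. -/
def wedgeL (n : ℕ) :
    EuclideanSpace ℝ (Fin n) →ₗ[ℝ] ExtCoord n →ₗ[ℝ] ExtCoord n :=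
  LinearMap.mk₂ ℝ wedgeV
    (fun x y f => by simp [wedgeV, add_smul, Finset.sum_add_distrib])
    (fun c x f => by simp [wedgeV, mul_smul, Finset.smul_sum])
    (fun x f g => by
      simp only [wedgeV, ← Finset.sum_add_distrib, ← smul_add]
      refine Finset.sum_congr rfl fun i _ => ?_
      congr 1
      ext S
      simp only [wedgeE, Pi.add_apply]
      split_ifs <;> ring)
    (fun c x f => by
      simp only [wedgeV, Finset.smul_sum]
      refine Finset.sum_congr rfl fun i _ => ?_
      ext S
      simp only [wedgeE, Pi.smul_apply, smul_eq_mul]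
      split_ifs <;> ring)

/-- Interior multiplication as a bilinear map. -/
def contrL (n : ℕ) :
    EuclideanSpace ℝ (Fin n) →ₗ[ℝ] ExtCoord n →ₗ[ℝ] ExtCoord n :=
  LinearMap.mk₂ ℝ (fun x f => ∑ i, x i • contrE i f)
    (fun x y f => by simp [add_smul, Finset.sum_add_distrib])
    (fun c x f => by simp [mul_smul, Finset.smul_sum])
    (fun x f g => by
      simp only [← Finset.sum_add_distrib, ← smul_add]
      refine Finset.sum_congr rfl fun i _ => ?_
      congr 1
      ext S
      simp only [contrE, Pi.add_apply]
      split_ifs <;> ring)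
    (fun c x f => by
      simp only [Finset.smul_sum]
      refine Finset.sum_congr rfl fun i _ => ?_
      ext S
      simp only [contrE, Pi.smul_apply, smul_eq_mul]
      split_ifs <;> ring)

/-- The inner product on the exterior algebra as a bilinear form. -/
def extInnerL (n : ℕ) : ExtCoord n →ₗ[ℝ] ExtCoord n →ₗ[ℝ] ℝ :=
  LinearMap.mk₂ ℝ extInner
    (fun f g h => by simp [extInner, add_mul, Finset.sum_add_distrib])
    (fun c f g => by simp [extInner, mul_assoc, Finset.mul_sum])
    (fun f g h => by simp [extInner, mul_add, Finset.sum_add_distrib])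
    (fun c f g => by simp [extInner, mul_left_comm, Finset.mul_sum])

lemma wedgeL_apply {n : ℕ} (x : EuclideanSpace ℝ (Fin n)) (f : ExtCoord n) :
    wedgeL n x f = wedgeV x f := rfl

lemma extInnerL_apply {n : ℕ} (f g : ExtCoord n) : extInnerL n f g = extInner f g := rfl

lemma wedgeL_estd {n : ℕ} (i : Fin n) (f : ExtCoord n) : wedgeL n (estd i) f = wedgeE i f := by
  simp [wedgeL_apply, wedgeV, estd]

lemma contrL_estd {n : ℕ} (i : Fin n) (f : ExtCoord n) : contrL n (estd i) f = contrE i f := by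
  simp [contrL, estd]

lemma sum_smul_estd {n : ℕ} (x : EuclideanSpace ℝ (Fin n)) : ∑ i, x i • estd i = x := by
  simpa [estd] using (EuclideanSpace.basisFun (Fin n) ℝ).sum_repr x

/-- Two linear maps on `ℝⁿ` agreeing on the standard basis are equal. -/
lemma linearMap_ext_estd {n : ℕ} {M : Type*} [AddCommGroup M] [Module ℝ M]
    {F G : EuclideanSpace ℝ (Fin n) →ₗ[ℝ] M} (h : ∀ i, F (estd i) = G (estd i)) : F = G := by
  ext x
  rw [← sum_smul_estd x]
  simp [h]

lemma wedgeL_wedgeL {n : ℕ} (x y : EuclideanSpace ℝ (Fin n)) (f : ExtCoord n) :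
    wedgeL n x (wedgeL n y f) = - wedgeL n y (wedgeL n x f) := by
  rw [← sum_smul_estd x, ← sum_smul_estd y]
  simp only [map_sum, map_smul, LinearMap.sum_apply, LinearMap.smul_apply, Finset.smul_sum,
    wedgeL_estd, ← Finset.sum_neg_distrib]
  rw [Finset.sum_comm]
  refine Finset.sum_congr rfl fun i _ => Finset.sum_congr rfl fun j _ => ?_
  rw [wedgeE_wedgeE, smul_comm, smul_neg, smul_neg]

lemma wedgeL_self {n : ℕ} (x : EuclideanSpace ℝ (Fin n)) (f : ExtCoord n) :
    wedgeL n x (wedgeL n x f) = 0 :=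
  self_eq_neg.mp (wedgeL_wedgeL x x f)

lemma contrL_wedgeL {n : ℕ} (x y : EuclideanSpace ℝ (Fin n)) (f : ExtCoord n) :
    contrL n x (wedgeL n y f) = (inner ℝ x y : ℝ) • f - wedgeL n y (contrL n x f) := by
  have hE : ∀ i, contrL n (estd i) (wedgeL n y f) =
      y i • f - wedgeL n y (contrL n (estd i) f) := fun i => by
    conv_lhs => rw [← sum_smul_estd y]
    conv_rhs =>
      enter [2]
      rw [← sum_smul_estd y]
    simp only [map_sum, map_smul, LinearMap.sum_apply, LinearMap.smul_apply, wedgeL_estd,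
      contrL_estd, contrE_wedgeE, smul_sub, Finset.sum_sub_distrib]
    simp
  have h := linearMap_ext_estd (F := (contrL n).flip (wedgeL n y f))
    (G := ((innerₗ _).flip y).smulRight f - wedgeL n y ∘ₗ (contrL n).flip f)
    (fun i => by
      have hi : (inner ℝ y (estd i) : ℝ) = y i := by simp [estd, EuclideanSpace.inner_single_right]
      simp [hE, hi])
  exact congrArg (fun F => F x) h

lemma extInner_wedgeL {n : ℕ} (x : EuclideanSpace ℝ (Fin n)) (f g : ExtCoord n) :
    extInnerL n (wedgeL n x f) g = extInnerL n f (contrL n x g) := by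
  rw [← sum_smul_estd x]
  simp only [map_sum, map_smul, LinearMap.sum_apply, LinearMap.smul_apply,
    wedgeL_estd, contrL_estd, extInnerL_apply, extInner_wedgeE]

/-- The contraction `T ↦ ∑ᵢ X(bᵢ) (β (T bᵢ))` over an orthonormal basis `b`. -/
def frameContr {V A M ι : Type*} [NormedAddCommGroup V] [InnerProductSpace ℝ V] [Fintype ι]
    [AddCommMonoid A] [Module ℝ A] [AddCommMonoid M] [Module ℝ M]
    (b : OrthonormalBasis ι ℝ V) (X : V →ₗ[ℝ] M →ₗ[ℝ] M) (β : A →ₗ[ℝ] M) :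
    (V →ₗ[ℝ] A) →ₗ[ℝ] M :=
  ∑ i, X (b i) ∘ₗ β ∘ₗ LinearMap.applyₗ (b i)

lemma frameContr_apply {V A M ι : Type*} [NormedAddCommGroup V] [InnerProductSpace ℝ V]
    [Fintype ι] [AddCommMonoid A] [Module ℝ A] [AddCommMonoid M] [Module ℝ M]
    (b : OrthonormalBasis ι ℝ V) (X : V →ₗ[ℝ] M →ₗ[ℝ] M) (β : A →ₗ[ℝ] M) (T : V →ₗ[ℝ] A) :
    frameContr b X β T = ∑ i, X (b i) (β (T (b i))) := by
  simp [frameContr]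

/-- The contraction does not depend on the orthonormal basis. -/
lemma frameContr_eq {V A M ι κ : Type*} [NormedAddCommGroup V] [InnerProductSpace ℝ V]
    [Fintype ι] [Fintype κ] [AddCommMonoid A] [Module ℝ A] [AddCommMonoid M] [Module ℝ M]
    (b : OrthonormalBasis ι ℝ V) (c : OrthonormalBasis κ ℝ V) :
    frameContr (A := A) (M := M) b = frameContr c := by
  funext X β
  ext T
  rw [frameContr_apply, frameContr_apply]
  have h1 : ∀ i, X (b i) (β (T (b i))) =
      ∑ a, (inner ℝ (c a) (b i) : ℝ) • X (b i) (β (T (c a))) := fun i => by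
    conv_lhs =>
      enter [2, 2, 2]
      rw [← c.sum_repr' (b i)]
    simp only [map_sum, map_smul]
  have h2 : ∀ a, X (c a) (β (T (c a))) =
      ∑ i, (inner ℝ (b i) (c a) : ℝ) • X (b i) (β (T (c a))) := fun a => by
    conv_lhs =>
      enter [1]
      rw [← b.sum_repr' (c a)]
    simp only [map_sum, map_smul, LinearMap.sum_apply, LinearMap.smul_apply]
  simp only [h1, h2]
  rw [Finset.sum_comm]
  simp only [real_inner_comm]

lemma frameContr_curvature {n : ℕ} {ι : Type*} [Fintype ι]
    (R : AlgCurv (EuclideanSpace ℝ (Fin n)))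
    (b : OrthonormalBasis ι ℝ (EuclideanSpace ℝ (Fin n))) (f : ExtCoord n) :
    frameContr b (wedgeL n) (frameContr b (contrL n) (frameContr b (wedgeL n)
        (frameContr b (contrL n) (LinearMap.toSpanSingleton ℝ _ f)))) R.T =
      ∑ i, ∑ j, ∑ k, ∑ l, R.T (b i) (b j) (b k) (b l) •
        wedgeL n (b i) (contrL n (b j) (wedgeL n (b k) (contrL n (b l) f))) := by
  simp only [frameContr_apply, LinearMap.toSpanSingleton_apply, map_sum, map_smul]

/-- The Weitzenböck operator computed in an arbitrary orthonormal basis. -/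
lemma weitz_eq_sum {n : ℕ} {ι : Type*} [Fintype ι] (R : AlgCurv (EuclideanSpace ℝ (Fin n)))
    (b : OrthonormalBasis ι ℝ (EuclideanSpace ℝ (Fin n))) (f : ExtCoord n) :
    weitz R f = ∑ i, ∑ j, ∑ k, ∑ l, R.T (b i) (b j) (b k) (b l) •
      wedgeL n (b i) (contrL n (b j) (wedgeL n (b k) (contrL n (b l) f))) := by
  have hstd : ∀ i, EuclideanSpace.basisFun (Fin n) ℝ i = estd i := fun i => by simp [estd]
  have h := frameContr_curvature R (EuclideanSpace.basisFun (Fin n) ℝ) f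
  simp only [frameContr_eq (EuclideanSpace.basisFun (Fin n) ℝ) b, hstd, wedgeL_estd,
    contrL_estd] at h
  rw [← frameContr_curvature R b, h]
  rfl

lemma wedgeL_foldr_of_mem {n : ℕ} {x : EuclideanSpace ℝ (Fin n)} (v : ExtCoord n) :
    ∀ {l : List (EuclideanSpace ℝ (Fin n))}, x ∈ l → wedgeL n x (l.foldr wedgeV v) = 0
  | y :: l, hx => by
    rw [List.foldr_cons, ← wedgeL_apply]
    rcases List.mem_cons.mp hx with rfl | hx
    · exact wedgeL_self _ _
    · rw [wedgeL_wedgeL, wedgeL_foldr_of_mem v hx, map_zero, neg_zero]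

lemma contrL_eB_empty {n : ℕ} (x : EuclideanSpace ℝ (Fin n)) : contrL n x (eB ∅) = 0 := by
  rw [← sum_smul_estd x]
  simp only [map_sum, map_smul, LinearMap.sum_apply, LinearMap.smul_apply, contrL_estd]
  refine Finset.sum_eq_zero fun i _ => ?_
  ext S
  simp [contrE, eB]

lemma contrL_foldr_of_orthogonal {n : ℕ} {x : EuclideanSpace ℝ (Fin n)} :
    ∀ {l : List (EuclideanSpace ℝ (Fin n))}, (∀ y ∈ l, inner ℝ x y = (0 : ℝ)) →
      contrL n x (l.foldr wedgeV (eB ∅)) = 0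
  | [], _ => contrL_eB_empty x
  | y :: l, hx => by
    rw [List.foldr_cons, ← wedgeL_apply, contrL_wedgeL, hx y (by simp),
      contrL_foldr_of_orthogonal fun z hz => hx z (by simp [hz])]
    simp

lemma extInnerL_foldr_self {n : ℕ} :
    ∀ {l : List (EuclideanSpace ℝ (Fin n))}, (∀ y ∈ l, inner ℝ y y = (1 : ℝ)) →
      l.Pairwise (fun x y => inner ℝ x y = (0 : ℝ)) →
      extInnerL n (l.foldr wedgeV (eB ∅)) (l.foldr wedgeV (eB ∅)) = 1
  | [], _, _ => by simp [extInnerL_apply, extInner, eB]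
  | y :: l, h1, h2 => by
    rw [List.pairwise_cons] at h2
    rw [List.foldr_cons, ← wedgeL_apply, extInner_wedgeL, contrL_wedgeL, h1 y (by simp),
      contrL_foldr_of_orthogonal h2.1, map_zero, sub_zero, one_smul]
    exact extInnerL_foldr_self (fun z hz => h1 z (by simp [hz])) h2.2

/-- Matrix coefficients of `(aᵃ)* aᵇ (aᶜ)* aᵈ` on a unit vector annihilated by exterior
multiplication with `b i` for `P i` and by contraction with `b i` for `¬ P i`. -/
lemma extInnerL_wedge_contr_wedge_contr {n : ℕ} {ι : Type*} [DecidableEq ι]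
    {b : ι → EuclideanSpace ℝ (Fin n)} (hb : Orthonormal ℝ b) (P : ι → Prop) [DecidablePred P]
    {ω : ExtCoord n} (hω : extInnerL n ω ω = 1) (hw : ∀ i, P i → wedgeL n (b i) ω = 0)
    (hc : ∀ i, ¬ P i → contrL n (b i) ω = 0) (i j k l : ι) :
    extInnerL n (wedgeL n (b i) (contrL n (b j) (wedgeL n (b k) (contrL n (b l) ω)))) ω =
      if P i then
        if P k then (if k = l then 1 else 0) * (if i = j then 1 else 0)
        else (if j = k then 1 else 0) * (if l = i then 1 else 0)
      else 0 := by
  have hin : ∀ a c, (inner ℝ (b a) (b c) : ℝ) = if a = c then 1 else 0 :=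
    orthonormal_iff_ite.mp hb
  have hwc : ∀ a c, P a → wedgeL n (b a) (contrL n (b c) ω) = (if c = a then (1 : ℝ) else 0) • ω := by
    intro a c ha
    have h := contrL_wedgeL (b c) (b a) ω
    rw [hw a ha, map_zero, hin] at h
    exact (sub_eq_zero.mp h.symm).symm
  by_cases hi : P i
  · by_cases hk : P k
    · rw [hwc k l hk]
      simp only [map_smul, hwc i j hi, LinearMap.smul_apply, hω, smul_eq_mul, mul_one, hi, hk,
        if_true, eq_comm]
    · rw [contrL_wedgeL, map_sub, map_smul, hwc i l hi, wedgeL_wedgeL, hin, map_sub, map_neg,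
        map_smul, map_smul, LinearMap.sub_apply, LinearMap.neg_apply, extInner_wedgeL, hc k hk]
      simp [hω, hi, hk, -ite_smul, -smul_ite]
  · rw [extInner_wedgeL, hc i hi, map_zero, if_neg hi]

/-- formula (prim): the diagonal of the Weitzenböck operator on a
decomposable `p`-vector `u¹ ∧ … ∧ u^p` made from an orthonormal basis equals
`Σ_{i=1}^p Σ_{j=p+1}^n K(uⁱ,uʲ)`. -/
theorem statement11 (n p : ℕ) (hp1 : 1 ≤ p) (hpn : p + 1 ≤ n)
    (R : AlgCurv (EuclideanSpace ℝ (Fin n)))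
    (u : Fin n → EuclideanSpace ℝ (Fin n)) (hu : Orthonormal ℝ u) :
    extInner
        (weitz R (wedgeFam fun i : Fin p => u (Fin.castLE (by omega) i)))
        (wedgeFam fun i : Fin p => u (Fin.castLE (by omega) i))
      = sumK R p u := by
  classical
  set ω := wedgeFam fun i : Fin p => u (Fin.castLE (by omega) i)
  have hin : ∀ a c, (inner ℝ (u a) (u c) : ℝ) = if a = c then 1 else 0 :=
    orthonormal_iff_ite.mp hu
  obtain ⟨b, hb⟩ : ∃ b : OrthonormalBasis (Fin n) ℝ (EuclideanSpace ℝ (Fin n)), ⇑b = u := by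
    have : Nonempty (Fin n) := ⟨⟨0, by omega⟩⟩
    have hcard : Fintype.card (Fin n) = Module.finrank ℝ (EuclideanSpace ℝ (Fin n)) := by simp
    exact ⟨(basisOfOrthonormalOfCardEqFinrank hu hcard).toOrthonormalBasis (by simpa using hu),
      by simp⟩
  have hω : extInnerL n ω ω = 1 := by
    refine extInnerL_foldr_self ?_ ?_
    · intro y hy
      obtain ⟨i, rfl⟩ := List.mem_ofFn.mp hy
      simp [hin, -inner_self_eq_norm_sq_to_K]
    · rw [List.pairwise_ofFn]
      intro i j hij
      rw [hin, if_neg (by simpa [Fin.ext_iff] using hij.ne)]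
  have hw : ∀ i : Fin n, (i : ℕ) < p → wedgeL n (u i) ω = 0 := fun i hi =>
    wedgeL_foldr_of_mem _ (List.mem_ofFn.mpr ⟨⟨i, hi⟩, rfl⟩)
  have hc : ∀ i : Fin n, ¬ (i : ℕ) < p → contrL n (u i) ω = 0 := by
    intro i hi
    refine contrL_foldr_of_orthogonal fun y hy => ?_
    obtain ⟨j, rfl⟩ := List.mem_ofFn.mp hy
    rw [hin, if_neg]
    rintro rfl
    exact hi j.isLt
  have hR₁ : ∀ x z w, R.T x x z w = 0 := fun x z w => self_eq_neg.mp (R.antisym₁ x x z w)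
  have hterm : ∀ i j k l : Fin n, R.T (u i) (u j) (u k) (u l) * extInnerL n
      (wedgeL n (u i) (contrL n (u j) (wedgeL n (u k) (contrL n (u l) ω)))) ω =
      if l = i then if k = j then if (i : ℕ) < p ∧ p ≤ (j : ℕ) then sectK R (u i) (u j)
        else 0 else 0 else 0 := by
    intro i j k l
    rw [extInnerL_wedge_contr_wedge_contr hu (fun i : Fin n => (i : ℕ) < p) hω hw hc]
    by_cases hi : (i : ℕ) < p
    · by_cases hk : (k : ℕ) < p
      · simp only [hi, hk, if_true, true_and]
        have h0 : (if l = i then if k = j then if p ≤ (j : ℕ) then sectK R (u i) (u j)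
            else 0 else 0 else 0) = 0 := by
          split_ifs with h1 h2 h3
          · subst h2
            omega
          all_goals rfl
        rw [h0]
        by_cases hij : i = j
        · rw [hij, hR₁, zero_mul]
        · simp [hij]
      · simp only [hi, hk, if_true, if_false, true_and]
        by_cases hl : l = i
        · by_cases hjk : k = j
          · subst hl hjk
            simp [not_lt.mp hk, sectK, R.antisym₂ (u l) (u k) (u l)]
          · simp [hjk, Ne.symm hjk]
        · simp [hl]
    · simp [hi]
  rw [weitz_eq_sum R b, hb, ← extInnerL_apply]
  simp only [map_sum, map_smul, LinearMap.sum_apply, LinearMap.smul_apply, smul_eq_mul, hterm]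
  simp only [Finset.sum_ite_eq', Finset.mem_univ, if_true, sumK, Finset.sum_filter, ite_and]
  refine Finset.sum_congr rfl fun i _ => ?_
  split_ifs <;> simp

end
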